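/- Let {B_k}_{k=0}^{d-1} be a Fourier family on ℂ^n and define S(α) = ∑_{k=1}^{d-1} ( γ(α)·X_d^k ⊗ B_k + δ_k(α)·Z_d^k ⊗ 𝟙_n ) acting on ℂ^d ⊗ ℂ^n. Then for every unit vector ψ ∈ ℂ^d ⊗ ℂ^n one has Re⟨ψ, S(α) ψ⟩ ≤ 1. -/

import Mathlib

open Matrix Kronecker Finset
open scoped ComplexOrder

noncomputable section

/-- `ω = exp(2πi/d)`. -/
def om (d : ℕ) : ℂ := Complex.exp (2 * Real.pi * Complex.I / d)

/-- The generalized Pauli matrix `Z_d = ∑_i ω^i |i⟩⟨i|`. -/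
def Zd (d : ℕ) : Matrix (Fin d) (Fin d) ℂ :=
  Matrix.diagonal fun i => om d ^ (i : ℕ)

/-- The generalized Pauli matrix `X_d = ∑_i |i+1 mod d⟩⟨i|`. -/
def Xd (d : ℕ) : Matrix (Fin d) (Fin d) ℂ :=
  Matrix.of fun i j => if (i : ℕ) = ((j : ℕ) + 1) % d then 1 else 0

/-- `γ(α) = d / ∑_{i≠j} α_i/α_j` (sum over ordered pairs `i ≠ j`). -/
def gam (d : ℕ) (α : Fin d → ℝ) : ℝ :=
  d / ∑ i : Fin d, ∑ j : Fin d, if i ≠ j then α i / α j else 0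

/-- `δ_k(α) = -(γ(α)/d) ∑_{i≠j} (α_i/α_j) ω^{k(d-j)}`. -/
def delt (d : ℕ) (α : Fin d → ℝ) (k : ℕ) : ℂ :=
  -(((gam d α : ℝ) : ℂ) / d) * ∑ i : Fin d, ∑ j : Fin d,
    if i ≠ j then ((α i / α j : ℝ) : ℂ) * om d ^ (k * (d - (j : ℕ))) else 0

/-- A Fourier family on `ℂ^n`: `B 0 = 1`, `Bₖ†Bₖ ≤ 𝟙`, and `B_{d-k} = Bₖ†` (the latter stated
via negation in `Fin d`). -/
def IsFourierFamily (d n : ℕ) (B : Fin d → Matrix (Fin n) (Fin n) ℂ) : Prop :=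
  (∀ k : Fin d, (k : ℕ) = 0 → B k = 1) ∧
  (∀ k : Fin d, ((1 : Matrix (Fin n) (Fin n) ℂ) - (B k)ᴴ * B k).PosSemidef) ∧
  (∀ k : Fin d, B (-k) = (B k)ᴴ)

/-- The operator `S(α) = ∑_{k=1}^{d-1} (γ(α)·X_d^k ⊗ B_k + δ_k(α)·Z_d^k ⊗ 𝟙_n)`. -/
def sOp (d n : ℕ) (α : Fin d → ℝ) (B : Fin d → Matrix (Fin n) (Fin n) ℂ) :
    Matrix (Fin d × Fin n) (Fin d × Fin n) ℂ :=
  ∑ k ∈ Finset.univ.filter (fun k : Fin d => (k : ℕ) ≠ 0),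
    (((gam d α : ℝ) : ℂ) • ((Xd d ^ (k : ℕ)) ⊗ₖ B k)
      + delt d α (k : ℕ) • ((Zd d ^ (k : ℕ)) ⊗ₖ (1 : Matrix (Fin n) (Fin n) ℂ)))


lemma aux_Xpow (d : ℕ) [NeZero d] (k : ℕ) (i j : Fin d) :
    (Xd d ^ k) i j = if (i : ℕ) = ((j : ℕ) + k) % d then 1 else 0 := by
  induction k generalizing i j with
  | zero =>
    simp [Matrix.one_apply, Nat.mod_eq_of_lt j.2, Fin.ext_iff]
  | succ k ih =>
    rw [pow_succ, Matrix.mul_apply]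
    simp only [ih]
    simp only [Xd, Matrix.of_apply]
    have hlt : ((j : ℕ) + 1) % d < d := Nat.mod_lt _ (NeZero.pos d)
    rw [Finset.sum_eq_single (⟨((j : ℕ) + 1) % d, hlt⟩ : Fin d)]
    · have : (((j : ℕ) + 1) % d + k) % d = ((j : ℕ) + (k + 1)) % d := by
        rw [Nat.mod_add_mod]; congr 1; ring
      simp [this]
    · intro b _ hb
      have : ¬ ((b : ℕ) = ((j : ℕ) + 1) % d) := fun h => hb (Fin.ext h)
      simp [this]
    · simp

lemma aux_root (d : ℕ) [NeZero d] (m j : Fin d) :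
    ∑ k : Fin d, om d ^ ((k : ℕ) * (d - (j : ℕ))) * (om d ^ (m : ℕ)) ^ (k : ℕ)
      = if m = j then (d : ℂ) else 0 := by
  have hp : IsPrimitiveRoot (om d) d := Complex.isPrimitiveRoot_exp d (NeZero.ne d)
  have h1 : ∀ k : ℕ, om d ^ (k * (d - (j : ℕ))) * (om d ^ (m : ℕ)) ^ k
      = (om d ^ (d - (j : ℕ) + m)) ^ k := by
    intro k
    rw [← pow_mul, ← pow_mul, ← pow_add]; congr 1; ring
  simp only [h1]
  rw [Fin.sum_univ_eq_sum_range (fun k => (om d ^ (d - (j : ℕ) + m)) ^ k)]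
  have hj := j.2
  have hm := m.2
  split_ifs with h
  · subst h
    have : d - (m : ℕ) + m = d := by omega
    simp [this, hp.pow_eq_one]
  · have hne : om d ^ (d - (j : ℕ) + m) ≠ 1 := by
      intro h2
      rw [hp.pow_eq_one_iff_dvd] at h2
      obtain ⟨c, hc⟩ := h2
      apply h
      apply Fin.ext
      have hc0 : 0 < c := by
        rcases Nat.eq_zero_or_pos c with h0 | h0
        · subst h0; omega
        · exact h0
      have hc2 : c < 2 := by
        by_contra hcc
        have : d * 2 ≤ d * c := Nat.mul_le_mul_left _ (by omega)
        omega
      have : c = 1 := by omega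
      subst this
      omega
    rw [geom_sum_eq hne, ← pow_mul, mul_comm, pow_mul, hp.pow_eq_one]
    simp

lemma aux_filter (d : ℕ) [NeZero d] (f : Fin d → ℂ) :
    ∑ k ∈ Finset.univ.filter (fun k : Fin d => (k : ℕ) ≠ 0), f k = ∑ k, f k - f 0 := by
  have h : Finset.univ.filter (fun k : Fin d => (k : ℕ) ≠ 0) = Finset.univ.erase 0 := by
    ext k; simp
  rw [h, ← Finset.add_sum_erase _ f (Finset.mem_univ 0)]; ring

lemma aux_sum_pos (d : ℕ) (hd : 2 ≤ d) (α : Fin d → ℝ) (hpos : ∀ i, 0 < α i) :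
    0 < ∑ i : Fin d, ∑ j : Fin d, if i ≠ j then α i / α j else 0 := by
  have hnn : ∀ i j : Fin d, 0 ≤ if i ≠ j then α i / α j else 0 := by
    intro i j
    split_ifs
    · exact (div_pos (hpos i) (hpos j)).le
    · exact le_rfl
  apply Finset.sum_pos'
  · intro i _; exact Finset.sum_nonneg fun j _ => hnn i j
  · refine ⟨⟨0, by omega⟩, Finset.mem_univ _, ?_⟩
    apply Finset.sum_pos'
    · intro j _; exact hnn _ j
    · refine ⟨⟨1, by omega⟩, Finset.mem_univ _, ?_⟩
      simp [div_pos (hpos _) (hpos _)]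

lemma aux_Z (d : ℕ) [NeZero d] (hd : 2 ≤ d) (α : Fin d → ℝ) (hpos : ∀ i, 0 < α i)
    (m : Fin d) :
    ∑ k ∈ Finset.univ.filter (fun k : Fin d => (k : ℕ) ≠ 0),
      delt d α (k : ℕ) * (om d ^ (m : ℕ)) ^ (k : ℕ)
      = ((1 - gam d α * ∑ i : Fin d, (if i ≠ m then α i / α m else 0) : ℝ) : ℂ) := by
  rw [aux_filter]
  have hS := aux_sum_pos d hd α hpos
  have hd0 : (d : ℝ) ≠ 0 := by exact_mod_cast NeZero.ne d
  have hdc : (d : ℂ) ≠ 0 := by exact_mod_cast NeZero.ne d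
  have h0 : delt d α ((0 : Fin d) : ℕ) * (om d ^ (m : ℕ)) ^ ((0 : Fin d) : ℕ) = -1 := by
    have : gam d α / d * ∑ i : Fin d, ∑ j : Fin d, (if i ≠ j then α i / α j else 0) = 1 := by
      unfold gam
      field_simp
    have h2 := congrArg (fun x : ℝ => (x : ℂ)) this
    simp only [Complex.ofReal_mul, Complex.ofReal_div, Complex.ofReal_sum, Complex.ofReal_natCast,
      Complex.ofReal_one, apply_ite (fun x : ℝ => (x : ℂ)), Complex.ofReal_zero] at h2
    simp only [delt, Fin.val_zero, zero_mul, pow_zero, mul_one, Complex.ofReal_div]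
    rw [neg_mul, h2]
  rw [h0]
  have h1 : ∑ k : Fin d, delt d α (k : ℕ) * (om d ^ (m : ℕ)) ^ (k : ℕ)
      = -((gam d α : ℝ) : ℂ) / d * ∑ i : Fin d, ∑ j : Fin d,
        if i ≠ j then ((α i / α j : ℝ) : ℂ) * (if m = j then (d : ℂ) else 0) else 0 := by
    simp only [← aux_root, delt, Finset.mul_sum, Finset.sum_mul]
    rw [Finset.sum_comm]
    refine Finset.sum_congr rfl fun i _ => ?_
    rw [Finset.sum_comm]
    refine Finset.sum_congr rfl fun j _ => ?_
    split_ifs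
    · rw [Finset.mul_sum]
      refine Finset.sum_congr rfl fun k _ => ?_
      ring
    · simp
  rw [h1]
  have h3 : ∀ i : Fin d, (∑ j : Fin d,
        if i ≠ j then ((α i / α j : ℝ) : ℂ) * (if m = j then (d : ℂ) else 0) else 0)
        = d * (((if i ≠ m then α i / α m else 0 : ℝ)) : ℂ) := by
    intro i
    rw [Finset.sum_eq_single m]
    · rw [if_pos rfl]; split_ifs <;> simp [mul_comm]
    · intro b _ hb
      simp [Ne.symm hb]
    · simp
  simp only [h3]
  rw [← Finset.mul_sum]
  push_cast
  field_simp
  ring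

lemma aux_entry (d n : ℕ) [NeZero d] (hd : 2 ≤ d) (α : Fin d → ℝ) (hpos : ∀ i, 0 < α i)
    (B : Fin d → Matrix (Fin n) (Fin n) ℂ) (i j : Fin d) (a b : Fin n) :
    sOp d n α B (i, a) (j, b) = ((gam d α : ℝ) : ℂ) * (if i ≠ j then B (i - j) a b else 0)
      + (if i = j then (if a = b then
        ((1 - gam d α * ∑ l : Fin d, (if l ≠ i then α l / α i else 0) : ℝ) : ℂ) else 0) else 0) := by
  rw [← aux_Z d hd α hpos i]
  simp only [sOp, Matrix.sum_apply, Matrix.add_apply, Matrix.smul_apply, Matrix.kroneckerMap_apply,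
    smul_eq_mul, aux_Xpow, Zd, Matrix.diagonal_pow, Matrix.diagonal_apply, Matrix.one_apply,
    Finset.sum_add_distrib, Pi.pow_apply]
  congr 1
  · rw [← Finset.mul_sum]
    congr 1
    rw [aux_filter]
    rw [Finset.sum_eq_single (i - j)]
    · have : (i : ℕ) = ((j : ℕ) + ((i - j : Fin d) : ℕ)) % d := by
        rw [← Fin.val_add]; simp
      rw [if_pos this]
      by_cases h : i = j
      · subst h
        simp [Nat.mod_eq_of_lt i.2]
      · have h' : ¬ ((i : ℕ) = j) := fun hh => h (Fin.ext hh)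
        simp [h, h', Nat.mod_eq_of_lt j.2]
    · intro k _ hk
      have : ¬ ((i : ℕ) = ((j : ℕ) + (k : ℕ)) % d) := by
        rw [← Fin.val_add]
        intro h
        apply hk
        have := Fin.ext h
        rw [this]; simp
      simp [this]
    · simp
  · split_ifs <;> simp

lemma aux_contr (n : ℕ) (M : Matrix (Fin n) (Fin n) ℂ)
    (hM : ((1 : Matrix (Fin n) (Fin n) ℂ) - Mᴴ * M).PosSemidef) (u v : Fin n → ℂ) (c : ℝ)
    (hc : 0 < c) :
    (star u ⬝ᵥ M.mulVec v).re ≤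
      (c * ∑ a, Complex.normSq (u a) + c⁻¹ * ∑ a, Complex.normSq (v a)) / 2 := by
  have hsq : ∀ w : Fin n → ℂ, (star w ⬝ᵥ w).re = ∑ a, Complex.normSq (w a) := by
    intro w
    simp [dotProduct, Complex.normSq_apply]
  have h1 : ∑ a, Complex.normSq (M.mulVec v a) ≤ ∑ a, Complex.normSq (v a) := by
    have h := hM.dotProduct_mulVec_nonneg v
    have h2 := (Complex.le_def.1 h).1
    rw [Matrix.sub_mulVec, Matrix.one_mulVec, dotProduct_sub, ← Matrix.mulVec_mulVec,
      Matrix.dotProduct_mulVec, ← Matrix.star_mulVec, Complex.sub_re, hsq, hsq] at h2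
    simpa using h2
  have h2 : (star u ⬝ᵥ M.mulVec v).re ≤
      (c * ∑ a, Complex.normSq (u a) + c⁻¹ * ∑ a, Complex.normSq (M.mulVec v a)) / 2 := by
    rw [dotProduct, Complex.re_sum, Finset.mul_sum, Finset.mul_sum, ← Finset.sum_add_distrib,
      Finset.sum_div]
    refine Finset.sum_le_sum fun a _ => ?_
    generalize M.mulVec v a = w
    simp only [Pi.star_apply, RCLike.star_def, Complex.mul_re, Complex.conj_re, Complex.conj_im,
      Complex.normSq_apply]
    have e : (c * ((u a).re * (u a).re + (u a).im * (u a).im) + c⁻¹ * (w.re * w.re + w.im * w.im)) / 2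
      - ((u a).re * w.re - -(u a).im * w.im)
      = c⁻¹ * ((c * (u a).re - w.re)^2 + (c * (u a).im - w.im)^2) / 2 := by
      field_simp; ring
    have : 0 ≤ c⁻¹ * ((c * (u a).re - w.re)^2 + (c * (u a).im - w.im)^2) / 2 := by positivity
    linarith
  have h3 := mul_le_mul_of_nonneg_left h1 (inv_pos.2 hc).le
  linarith

/-- for any Fourier family `B` on `ℂ^n` and any unit vector `ψ ∈ ℂ^d ⊗ ℂ^n`,
`Re⟨ψ, S(α) ψ⟩ ≤ 1`. -/
theorem sOp_bound (d n : ℕ) [NeZero d] (hd : 2 ≤ d)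
    (α : Fin d → ℝ) (hpos : ∀ i, 0 < α i) (hnorm : ∑ i, α i ^ 2 = 1)
    (B : Fin d → Matrix (Fin n) (Fin n) ℂ) (hB : IsFourierFamily d n B)
    (ψ : Fin d × Fin n → ℂ) (hψ : ∑ p, Complex.normSq (ψ p) = 1) :
    (star ψ ⬝ᵥ (sOp d n α B).mulVec ψ).re ≤ 1 := by
  have hg : 0 ≤ gam d α := div_nonneg (Nat.cast_nonneg d) (aux_sum_pos d hd α hpos).le
  set N : Fin d → ℝ := fun i => ∑ a, Complex.normSq (ψ (i, a)) with hN
  have hN1 : ∑ i, N i = 1 := by rw [← hψ, Fintype.sum_prod_type]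
  have key : star ψ ⬝ᵥ (sOp d n α B).mulVec ψ =
      ((gam d α : ℝ) : ℂ) * (∑ i, ∑ j, if i ≠ j then
        star (fun a => ψ (i, a)) ⬝ᵥ (B (i - j)).mulVec (fun b => ψ (j, b)) else 0)
      + ∑ i, (((1 - gam d α * ∑ l : Fin d, (if l ≠ i then α l / α i else 0)) * N i : ℝ) : ℂ) := by
    simp only [dotProduct, Matrix.mulVec, Fintype.sum_prod_type, aux_entry d n hd α hpos]
    rw [Finset.mul_sum, ← Finset.sum_add_distrib]
    refine Finset.sum_congr rfl fun i _ => ?_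
    simp only [add_mul, Finset.sum_add_distrib, mul_add]
    congr 1
    · rw [Finset.mul_sum]
      simp only [Finset.mul_sum]
      rw [Finset.sum_comm]
      refine Finset.sum_congr rfl fun j _ => ?_
      split_ifs
      · rw [Finset.mul_sum]
        refine Finset.sum_congr rfl fun a _ => ?_
        rw [Finset.mul_sum]
        refine Finset.sum_congr rfl fun b _ => ?_
        simp only [Pi.star_apply]
        ring
      · simp
    · have er : ∀ x : ℝ, ((x * N i : ℝ) : ℂ) = ∑ a, (x : ℂ) * (Complex.normSq (ψ (i, a)) : ℂ) := by
        intro x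
        rw [hN, Complex.ofReal_mul, Complex.ofReal_sum, Finset.mul_sum]
      rw [er]
      refine Finset.sum_congr rfl fun a _ => ?_
      rw [Finset.sum_eq_single i]
      · rw [Finset.sum_eq_single a]
        · rw [if_pos rfl, if_pos rfl, Complex.normSq_eq_conj_mul_self]
          simp only [Pi.star_apply, RCLike.star_def]
          ring
        · intro b _ hb
          simp [Ne.symm hb]
        · simp
      · intro j _ hj
        simp [Ne.symm hj]
      · simp
  rw [key, Complex.add_re, Complex.re_ofReal_mul, ← Complex.ofReal_sum, Complex.ofReal_re,
    Complex.re_sum]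
  have b1 : ∑ i, (∑ j, if i ≠ j then
        star (fun a => ψ (i, a)) ⬝ᵥ (B (i - j)).mulVec (fun b => ψ (j, b)) else 0).re
      ≤ ∑ i, ∑ j, ((if j ≠ i then α j / α i else 0) * N i
        + (if i ≠ j then α i / α j else 0) * N j) / 2 := by
    refine Finset.sum_le_sum fun i _ => ?_
    rw [Complex.re_sum]
    refine Finset.sum_le_sum fun j _ => ?_
    by_cases h : i = j
    · simp [h]
    · rw [if_pos h, if_pos h, if_pos (Ne.symm h)]
      have := aux_contr n (B (i - j)) (hB.2.1 _) (fun a => ψ (i, a)) (fun b => ψ (j, b))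
        (α j / α i) (div_pos (hpos j) (hpos i))
      rwa [inv_div] at this
  have b2 : ∑ i, ∑ j, ((if j ≠ i then α j / α i else 0) * N i
        + (if i ≠ j then α i / α j else 0) * N j) / 2
      = ∑ i, (∑ l, if l ≠ i then α l / α i else 0) * N i := by
    have e : ∑ i, ∑ j, (if i ≠ j then α i / α j else 0) * N j
        = ∑ i, ∑ j, (if j ≠ i then α j / α i else 0) * N i := by
      rw [Finset.sum_comm]
    simp only [← Finset.sum_div, Finset.sum_add_distrib, Finset.sum_mul]
    rw [e]; ring
  rw [b2] at b1
  have b3 := mul_le_mul_of_nonneg_left b1 hg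
  have b4 : ∑ i, (1 - gam d α * ∑ l : Fin d, (if l ≠ i then α l / α i else 0)) * N i
      = 1 - gam d α * ∑ i, (∑ l, if l ≠ i then α l / α i else 0) * N i := by
    simp only [sub_mul, one_mul, Finset.sum_sub_distrib, hN1, mul_assoc, ← Finset.mul_sum]
  rw [b4]
  linarith
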